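/- Let G = (V, E) be a digraph rooted at v, let u ∈ V, and set F = root_u(G[dom_G(u)]). Then the domination relation in F with respect to its root u agrees with that in G: for all vertices x, w ∈ dom_G(u), x dominates w in F (with respect to u) if and only if x dominates w in G (with respect to v). -/

import Mathlib

open MvPolynomial

/-- A finite directed (multi)graph with abstractly named edges: a finite set of
vertices, a finite set of edge names, and source/target maps.  Edge names double
as the labels/variables of the Kirchhoff polynomial. -/
structure MultiDigraph (V : Type*) (ε : Type*) where
  verts : Finset V
  edges : Finset ε
  src : ε → V
  tgt : ε → V

namespace MultiDigraph

variable {V : Type*} {ε : Type*} [DecidableEq V] [DecidableEq ε]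

/-- One step along an edge of `A`. -/
def Step (G : MultiDigraph V ε) (A : Finset ε) (x y : V) : Prop :=
  ∃ e ∈ A, G.src e = x ∧ G.tgt e = y

/-- Directed reachability using only edges of `A`. -/
def Reaches (G : MultiDigraph V ε) (A : Finset ε) (x y : V) : Prop :=
  Relation.ReflTransGen (G.Step A) x y

/-- Every edge has both of its endpoints among the vertices. -/
def WellFormed (G : MultiDigraph V ε) : Prop :=
  ∀ e ∈ G.edges, G.src e ∈ G.verts ∧ G.tgt e ∈ G.verts

/-- `G` is a simple digraph: it has no loops and no parallel edges. -/
def Simple (G : MultiDigraph V ε) : Prop :=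
  (∀ e ∈ G.edges, G.src e ≠ G.tgt e) ∧
    ∀ e ∈ G.edges, ∀ e' ∈ G.edges, G.src e = G.src e' → G.tgt e = G.tgt e' → e = e'

/-- `A` is (the edge set of) an arborescence of `G` rooted at `r`: a spanning
subdigraph in which every vertex other than the root has exactly one incoming
edge, the root has none, and every vertex is reachable from the root (hence
along a unique directed path). -/
def IsArbAt (G : MultiDigraph V ε) (A : Finset ε) (r : V) : Prop :=
  A ⊆ G.edges ∧ r ∈ G.verts ∧
  (∀ e ∈ A, G.src e ∈ G.verts ∧ G.tgt e ∈ G.verts) ∧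
  (∀ e ∈ A, G.tgt e ≠ r) ∧
  (∀ w ∈ G.verts, w ≠ r → ∃! e, e ∈ A ∧ G.tgt e = w) ∧
  (∀ w ∈ G.verts, G.Reaches A r w)

/-- `A` is an arborescence of `G` (rooted at some vertex). -/
def IsArb (G : MultiDigraph V ε) (A : Finset ε) : Prop :=
  ∃ r, G.IsArbAt A r

open Classical in
/-- The Kirchhoff polynomial of `G`: the sum, over all arborescences, of the
products of the variables of their edges. -/
noncomputable def kirchhoff (G : MultiDigraph V ε) : MvPolynomial ε ℚ :=
  ∑ A ∈ G.edges.powerset.filter (fun A => G.IsArb A), ∏ e ∈ A, X e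

open Classical in
/-- The Kirchhoff polynomial of arborescences of `G` rooted at `r`. -/
noncomputable def kirchhoffAt (G : MultiDigraph V ε) (r : V) : MvPolynomial ε ℚ :=
  ∑ A ∈ G.edges.powerset.filter (fun A => G.IsArbAt A r), ∏ e ∈ A, X e

/-- The incoming edges of vertex `v`. -/
def inEdges (G : MultiDigraph V ε) (v : V) : Finset ε :=
  G.edges.filter (fun e => G.tgt e = v)

/-- `G` is rooted at `v`: `v` has no incoming edges and every vertex is
reachable from `v`. -/
def RootedAt (G : MultiDigraph V ε) (v : V) : Prop :=
  v ∈ G.verts ∧ (∀ e ∈ G.edges, G.tgt e ≠ v) ∧ ∀ w ∈ G.verts, G.Reaches G.edges v w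

/-- `G` is strongly connected. -/
def StronglyConnected (G : MultiDigraph V ε) : Prop :=
  ∀ x ∈ G.verts, ∀ y ∈ G.verts, G.Reaches G.edges x y

/-- `G` is (weakly) connected. -/
def WeaklyConnected (G : MultiDigraph V ε) : Prop :=
  ∀ x ∈ G.verts, ∀ y ∈ G.verts,
    Relation.ReflTransGen (fun a b => G.Step G.edges a b ∨ G.Step G.edges b a) x y

/-- The induced subdigraph `G[D]`. -/
def induce (G : MultiDigraph V ε) (D : Finset V) : MultiDigraph V ε where
  verts := D
  edges := G.edges.filter (fun e => G.src e ∈ D ∧ G.tgt e ∈ D)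
  src := G.src
  tgt := G.tgt

/-- `root_u(G)`: remove all edges incoming to `u`. -/
def rootAt (G : MultiDigraph V ε) (u : V) : MultiDigraph V ε where
  verts := G.verts
  edges := G.edges.filter (fun e => G.tgt e ≠ u)
  src := G.src
  tgt := G.tgt

/-- Delete a single edge. -/
def deleteEdge (G : MultiDigraph V ε) (e₀ : ε) : MultiDigraph V ε where
  verts := G.verts
  edges := G.edges.erase e₀
  src := G.src
  tgt := G.tgt

/-- The contraction `G(S → u)`: all edges from `Vᶜ∖S` into `S∖{u}` and all edges
inside `S` are removed, and `S` is contracted into the single vertex `u`;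
edges retain their names (labels). -/
def contract (G : MultiDigraph V ε) (S : Finset V) (u : V) : MultiDigraph V ε where
  verts := insert u (G.verts \ S)
  edges := G.edges.filter (fun e => G.tgt e ∉ S ∨ (G.src e ∉ S ∧ G.tgt e = u))
  src := fun e => if G.src e ∈ S then u else G.src e
  tgt := fun e => if G.tgt e ∈ S then u else G.tgt e

/-- Directed walks from `x` to `y`, given as lists of edges taken from `A`. -/
def IsWalk (G : MultiDigraph V ε) (A : Finset ε) : List ε → V → V → Prop
  | [], x, y => x = y
  | e :: p, x, y => e ∈ A ∧ G.src e = x ∧ IsWalk G A p (G.tgt e) y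

/-- A simple directed path from `x` to `y` (no repeated vertices). -/
def IsPath (G : MultiDigraph V ε) (A : Finset ε) (p : List ε) (x y : V) : Prop :=
  G.IsWalk A p x y ∧ (x :: p.map G.tgt).Nodup

/-- A simple directed cycle through `x` (no repeated vertices). -/
def IsCycle (G : MultiDigraph V ε) (A : Finset ε) (p : List ε) (x : V) : Prop :=
  p ≠ [] ∧ G.IsWalk A p x x ∧ (p.map G.tgt).Nodup

/-- The edge set `A` contains no directed cycle. -/
def Acyclic (G : MultiDigraph V ε) (A : Finset ε) : Prop :=
  ¬ ∃ p x, G.IsCycle A p x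

/-- In `G` rooted at `v`, vertex `u` dominates vertex `w`: every directed path
from `v` to `w` passes through `u`. -/
def Dominates (G : MultiDigraph V ε) (v u w : V) : Prop :=
  ∀ p : List ε, G.IsPath G.edges p v w → u ∈ v :: p.map G.tgt

open Classical in
/-- `dom_G(u)` (w.r.t. the root `v`): the set of all vertices dominated by `u`. -/
noncomputable def domSet (G : MultiDigraph V ε) (v u : V) : Finset V :=
  G.verts.filter (fun w => G.Dominates v u w)

/-- In `G` rooted at `v`, `y` is an immediate dominator of `z`. -/
def ImmDominates (G : MultiDigraph V ε) (v y z : V) : Prop :=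
  y ≠ z ∧ G.Dominates v y z ∧
    ∀ x ∈ G.verts, x ≠ y → x ≠ z → G.Dominates v x z → G.Dominates v x y

open Classical in
/-- `imm_G(y)` (w.r.t. the root `v`): the set of vertices immediately dominated by `y`. -/
noncomputable def immSet (G : MultiDigraph V ε) (v y : V) : Finset V :=
  G.verts.filter (fun z => G.ImmDominates v y z)

open Classical in
/-- The simultaneous contraction `G(dom(z₁) → z₁; …; dom(z_i) → z_i)` for
`Z = {z₁, …, z_i}` (domination w.r.t. the root `v`). -/
noncomputable def domContract (G : MultiDigraph V ε) (v : V) (Z : Finset V) :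
    MultiDigraph V ε where
  verts := G.verts.filter (fun x => ∀ z ∈ Z, G.Dominates v z x → x = z)
  edges := G.edges.filter (fun e =>
    (∀ z ∈ Z, ¬(G.Dominates v z (G.src e) ∧ G.Dominates v z (G.tgt e))) ∧
    (∀ z ∈ Z, ¬(¬ G.Dominates v z (G.src e) ∧ G.Dominates v z (G.tgt e) ∧ G.tgt e ≠ z)))
  src := fun e =>
    if h : ∃ z ∈ Z, G.Dominates v z (G.src e) ∧ G.src e ≠ z then h.choose else G.src e
  tgt := fun e =>
    if h : ∃ z ∈ Z, G.Dominates v z (G.tgt e) ∧ G.tgt e ≠ z then h.choose else G.tgt e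

/-- Mutual directed reachability in `G`. -/
def MutuallyReachable (G : MultiDigraph V ε) (x y : V) : Prop :=
  G.Reaches G.edges x y ∧ G.Reaches G.edges y x

open Classical in
/-- `W` is (the vertex set of) a strongly connected component of `G`, i.e. an
equivalence class of mutual reachability. -/
def IsSCC (G : MultiDigraph V ε) (W : Finset V) : Prop :=
  ∃ x ∈ G.verts, W = G.verts.filter (fun y => G.MutuallyReachable x y)

/-- `W` is a minimal element in the partial order that reachability induces on
the strongly connected components of `G` (an initial SCC). -/
def IsMinimalSCC (G : MultiDigraph V ε) (W : Finset V) : Prop :=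
  G.IsSCC W ∧ ∀ W', G.IsSCC W' → (∃ x ∈ W', ∃ y ∈ W, G.Reaches G.edges x y) → W' = W

open Classical in
/-- The digraph `Ĝ(W)` associated with a strongly connected component `G[W]`:
if `G[W]` has no incoming edges (it is the initial SCC) it is `G[W]` itself;
otherwise a new auxiliary vertex (here `none`) is added and every edge of `G`
entering `W` from outside is redirected to start at the auxiliary vertex,
keeping its label. -/
noncomputable def hatSCC (G : MultiDigraph V ε) (W : Finset V) :
    MultiDigraph (Option V) ε where
  verts :=
    if ∃ e ∈ G.edges, G.tgt e ∈ W ∧ G.src e ∉ W then insert none (W.image some)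
    else W.image some
  edges := G.edges.filter (fun e => G.tgt e ∈ W)
  src := fun e => if G.src e ∈ W then some (G.src e) else none
  tgt := fun e => some (G.tgt e)

/-- `u` is an independent vertex of the simple directed cycle `C` (w.r.t. the
root `v`): `u` lies on `C` and there is a simple directed path from `v` to `u`
which is vertex-disjoint from `C` except at `u`. -/
def IsIndependentVertex (G : MultiDigraph V ε) (v : V) (C : List ε) (u : V) : Prop :=
  u ∈ C.map G.tgt ∧ ∃ p, G.IsPath G.edges p v u ∧
    ∀ z ∈ v :: p.map G.tgt, z ∈ C.map G.tgt → z = u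

end MultiDigraph

namespace MultiDigraph

variable {V : Type*} {ε : Type*} {G : MultiDigraph V ε} {A : Finset ε}

theorem IsWalk.append {p q : List ε} {x y z : V} (hp : G.IsWalk A p x y)
    (hq : G.IsWalk A q y z) : G.IsWalk A (p ++ q) x z := by
  induction p generalizing x with
  | nil => cases hp; exact hq
  | cons e p ih => exact ⟨hp.1, hp.2.1, ih hp.2.2⟩

theorem IsWalk.end_mem {p : List ε} {x y : V} (hp : G.IsWalk A p x y) :
    y ∈ x :: p.map G.tgt := by
  induction p generalizing x with
  | nil => cases hp; simp
  | cons e p ih => exact List.mem_cons_of_mem _ (ih hp.2.2)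

theorem IsWalk.exists_split {p : List ε} {x y z : V} (hp : G.IsWalk A p x y)
    (hz : z ∈ x :: p.map G.tgt) :
    ∃ p₁ p₂, p = p₁ ++ p₂ ∧ G.IsWalk A p₁ x z ∧ G.IsWalk A p₂ z y := by
  induction p generalizing x with
  | nil =>
    obtain rfl : z = x := by simpa using hz
    exact ⟨[], [], rfl, rfl, hp⟩
  | cons e p ih =>
    rcases List.mem_cons.1 hz with rfl | hz
    · exact ⟨[], e :: p, rfl, rfl, hp⟩
    · obtain ⟨p₁, p₂, rfl, h₁, h₂⟩ := ih hp.2.2 hz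
      exact ⟨e :: p₁, p₂, rfl, ⟨hp.1, hp.2.1, h₁⟩, h₂⟩

/-- A path whose initial part is a walk to `z` does not meet `z` afterwards. -/
theorem IsWalk.notMem_of_nodup {p₁ p₂ : List ε} {x z : V} (h₁ : G.IsWalk A p₁ x z)
    (hn : (x :: (p₁ ++ p₂).map G.tgt).Nodup) : z ∉ p₂.map G.tgt := by
  rw [List.map_append, ← List.cons_append] at hn
  exact (List.disjoint_of_nodup_append hn) h₁.end_mem

/-- Every walk contains a path with the same endpoints. -/
theorem IsWalk.exists_isPath {p : List ε} {x y : V} (hp : G.IsWalk A p x y) :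
    ∃ q, G.IsPath A q x y ∧ q ⊆ p := by
  induction p generalizing x with
  | nil => exact ⟨[], ⟨hp, by simp⟩, by simp⟩
  | cons e p ih =>
    obtain ⟨q, ⟨hq, hn⟩, hqp⟩ := ih hp.2.2
    by_cases hx : x ∈ G.tgt e :: q.map G.tgt
    · obtain ⟨q₁, q₂, rfl, h₁, h₂⟩ := hq.exists_split hx
      refine ⟨q₂, ⟨h₂, List.nodup_cons.2 ⟨h₁.notMem_of_nodup hn, ?_⟩⟩, fun a ha =>
        List.mem_cons_of_mem _ (hqp (List.mem_append_right _ ha))⟩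
      rw [List.map_append, ← List.cons_append] at hn
      exact hn.of_append_right
    · exact ⟨e :: q, ⟨⟨hp.1, hp.2.1, hq⟩, List.nodup_cons.2 ⟨hx, hn⟩⟩,
        List.cons_subset_cons e hqp⟩

theorem Reaches.exists_isWalk {x y : V} (h : G.Reaches A x y) : ∃ p, G.IsWalk A p x y := by
  induction h with
  | refl => exact ⟨[], rfl⟩
  | tail _ hstep ih =>
    obtain ⟨p, hp⟩ := ih
    obtain ⟨e, he, hs, rfl⟩ := hstep
    exact ⟨p ++ [e], hp.append ⟨he, hs, rfl⟩⟩

/-- A dominator lies on every walk from the root, not only on every path. -/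
theorem Dominates.mem_of_isWalk {v u w : V} (h : G.Dominates v u w) {p : List ε}
    (hp : G.IsWalk G.edges p v w) : u ∈ v :: p.map G.tgt := by
  obtain ⟨q, hq, hqp⟩ := hp.exists_isPath
  exact List.cons_subset_cons v (List.map_subset _ hqp) (h q hq)

/-- On a path to `u`, the only vertex that `u` can dominate is `u` itself. -/
theorem IsPath.eq_of_dominates {v u x : V} {p : List ε} (hp : G.IsPath G.edges p v u)
    (hx : x ∈ v :: p.map G.tgt) (hd : G.Dominates v u x) : x = u := by
  obtain ⟨p₁, p₂, rfl, h₁, h₂⟩ := hp.1.exists_split hx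
  have hu := hd.mem_of_isWalk h₁
  have hn := hp.2
  rw [List.map_append, ← List.cons_append] at hn
  rcases List.mem_cons.1 h₂.end_mem with h | h
  · exact h.symm
  · exact (List.disjoint_of_nodup_append hn hu h).elim

/-- Walks of `root_u(G[D])` are walks of `G`. -/
theorem IsWalk.of_rootAt_induce [DecidableEq V] {D : Finset V} {u x y : V} {p : List ε}
    (hp : ((G.induce D).rootAt u).IsWalk ((G.induce D).rootAt u).edges p x y) :
    G.IsWalk G.edges p x y := by
  induction p generalizing x with
  | nil => exact hp
  | cons e p ih =>
    exact ⟨Finset.mem_of_mem_filter e (Finset.mem_of_mem_filter e hp.1), hp.2.1, ih hp.2.2⟩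

theorem mem_domSet {v u w : V} : w ∈ G.domSet v u ↔ w ∈ G.verts ∧ G.Dominates v u w := by
  simp [domSet]

/-- A walk from `dom(u)` to a vertex of `dom(u)` that does not enter `u` stays in `dom(u)`. -/
theorem IsWalk.rootAt_induce_domSet [DecidableEq V] (hwf : G.WellFormed) {v u a w : V}
    (hw : G.Dominates v u w) {p : List ε} (hp : G.IsWalk G.edges p a w)
    (ha : a ∈ G.domSet v u) (hu : u ∉ p.map G.tgt) :
    ((G.induce (G.domSet v u)).rootAt u).IsWalk
      ((G.induce (G.domSet v u)).rootAt u).edges p a w := by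
  induction p generalizing a with
  | nil => exact hp
  | cons e p ih =>
    obtain ⟨he, rfl, hp⟩ := hp
    rw [List.map_cons, List.mem_cons, not_or] at hu
    have ht : G.tgt e ∈ G.domSet v u := by
      refine mem_domSet.2 ⟨(hwf e he).2, fun r hr => ?_⟩
      have := hw.mem_of_isWalk (hr.1.append hp)
      rw [List.map_append, ← List.cons_append] at this
      exact (List.mem_append.1 this).resolve_right hu.2
    exact ⟨Finset.mem_filter.2 ⟨Finset.mem_filter.2 ⟨he, ha, ht⟩, Ne.symm hu.1⟩, rfl,
      ih hp ht hu.2⟩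

end MultiDigraph

open MvPolynomial

variable {V : Type*} {ε : Type*} [DecidableEq V] [DecidableEq ε]

/-- For `G` rooted at `v`, `u ∈ V` and `F = root_u(G[dom_G(u)])`:
for all `x, w ∈ dom_G(u)`, `x` dominates `w` in `F` (w.r.t. root `u`) iff `x` dominates
`w` in `G` (w.r.t. root `v`). -/
theorem statement_16 (G : MultiDigraph V ε) (hwf : G.WellFormed) (hsimple : G.Simple)
    (v : V) (hroot : G.RootedAt v) (u : V) (hu : u ∈ G.verts)
    (x w : V) (hx : x ∈ G.domSet v u) (hw : w ∈ G.domSet v u) :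
    ((G.induce (G.domSet v u)).rootAt u).Dominates u x w ↔ G.Dominates v x w := by
  have hdw : G.Dominates v u w := (MultiDigraph.mem_domSet.1 hw).2
  constructor
  · intro h p hp
    obtain ⟨p₁, p₂, rfl, h₁, h₂⟩ := hp.1.exists_split (hdw p hp)
    have hu₂ := h₁.notMem_of_nodup hp.2
    have huD : u ∈ G.domSet v u := MultiDigraph.mem_domSet.2 ⟨hu, fun r hr => hr.1.end_mem⟩
    have hn := hp.2
    rw [List.map_append, ← List.cons_append] at hn ⊢
    have hmem : x ∈ u :: p₂.map G.tgt :=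
      h p₂ ⟨h₂.rootAt_induce_domSet hwf hdw huD hu₂,
        List.nodup_cons.2 ⟨hu₂, hn.of_append_right⟩⟩
    rcases List.mem_cons.1 hmem with rfl | hmem
    · exact List.mem_append_left _ h₁.end_mem
    · exact List.mem_append_right _ hmem
  · intro h q hq
    obtain ⟨p₀, hp₀⟩ := (hroot.2.2 u hu).exists_isWalk
    obtain ⟨p, hp, -⟩ := hp₀.exists_isPath
    have hmem := h.mem_of_isWalk (hp.1.append hq.1.of_rootAt_induce)
    rw [List.map_append, ← List.cons_append] at hmem
    rcases List.mem_append.1 hmem with hmem | hmem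
    · rw [hp.eq_of_dominates hmem (MultiDigraph.mem_domSet.1 hx).2]
      exact List.mem_cons_self
    · exact List.mem_cons_of_mem _ hmem
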